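/- Fix an integer s ≥ 2. If μ is a Borel probability measure on ℝ whose support is contained in the interval [0, K] and whose moments are the Fuss–Catalan numbers, i.e. ∫ x^k dμ(x) = (1/(sk+1)) · binomial((s+1)k, k) for every natural number k, then μ equals the measure on ℝ with density π_s · 1_{(0,K]} with respect to Lebesgue measure. -/

import Mathlib

open MeasureTheory Real

noncomputable def eulerBeta (a b : ℝ) : ℝ := Real.Gamma a * Real.Gamma b / Real.Gamma (a + b)

noncomputable def Kc (s : ℕ) : ℝ := ((s : ℝ) + 1) ^ (s + 1) / (s : ℝ) ^ s

noncomputable def tauProd {s : ℕ} (t : Fin s → ℝ) : ℝ := ∏ i, t i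

def cube (s : ℕ) : Set (Fin s → ℝ) := Set.univ.pi fun _ => Set.Icc (0 : ℝ) 1

noncomputable def Cnorm (s : ℕ) : ℝ :=
  1 / (eulerBeta (1 / ((s : ℝ) + 1)) (((s : ℝ) - 1) / (2 * (s : ℝ) + 2)) *
      ∏ j ∈ Finset.Icc 2 s,
        eulerBeta ((j : ℝ) / ((s : ℝ) + 1)) ((j : ℝ) / ((s : ℝ) * ((s : ℝ) + 1))))

noncomputable def Fdens (s : ℕ) (t : Fin s → ℝ) : ℝ :=
  Cnorm s * ∏ i : Fin s,
    if (i : ℕ) = 0 then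
      t i ^ (1 / ((s : ℝ) + 1) - 1) * (1 - t i) ^ (((s : ℝ) - 1) / (2 * (s : ℝ) + 2) - 1)
    else
      t i ^ ((((i : ℕ) : ℝ) + 1) / ((s : ℝ) + 1) - 1) *
        (1 - t i) ^ ((((i : ℕ) : ℝ) + 1) / ((s : ℝ) * ((s : ℝ) + 1)) - 1)

noncomputable def piDens (s : ℕ) (x : ℝ) : ℝ :=
  (1 / eulerBeta (1 / 2) (1 / 2 + 1 / (s : ℝ))) *
    ∫ t in cube s,
      if x ≤ tauProd t * Kc s then
        (tauProd t * Kc s - x) ^ (1 / (s : ℝ) - 1 / 2) * x ^ (-(1 : ℝ) / 2) *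
          (tauProd t * Kc s) ^ (-(1 : ℝ) / (s : ℝ)) * Fdens s t
      else 0


open Set in
lemma lint_beta {a b : ℝ} (ha : 0 < a) (hb : 0 < b) :
    ∫⁻ u in Ioo (0:ℝ) 1, ENNReal.ofReal (u ^ (a - 1) * (1 - u) ^ (b - 1))
      = ENNReal.ofReal (eulerBeta a b) := by
  have h := ProbabilityTheory.lintegral_betaPDF_eq_one ha hb
  have hB : 0 < ProbabilityTheory.beta a b := ProbabilityTheory.beta_pos ha hb
  rw [ProbabilityTheory.lintegral_betaPDF] at h
  have : ∀ x : ℝ, ENNReal.ofReal (1 / ProbabilityTheory.beta a b * x ^ (a - 1) * (1 - x) ^ (b - 1))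
      = ENNReal.ofReal (1 / ProbabilityTheory.beta a b) *
        ENNReal.ofReal (x ^ (a - 1) * (1 - x) ^ (b - 1)) := by
    intro x
    rw [mul_assoc, ENNReal.ofReal_mul (by positivity)]
  simp_rw [this] at h
  rw [lintegral_const_mul _ (by fun_prop)] at h
  have e : eulerBeta a b = ProbabilityTheory.beta a b := rfl
  rw [e]
  calc _ = (ENNReal.ofReal (ProbabilityTheory.beta a b) *
          ENNReal.ofReal (1 / ProbabilityTheory.beta a b)) *
          ∫⁻ u in Ioo (0:ℝ) 1, ENNReal.ofReal (u ^ (a - 1) * (1 - u) ^ (b - 1)) := by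
        rw [← ENNReal.ofReal_mul hB.le, mul_one_div_cancel hB.ne']; simp
    _ = _ := by rw [mul_assoc, h, mul_one]

open Set in
lemma lint_beta_scaled {a b y : ℝ} (ha : 0 < a) (hb : 0 < b) (hy : 0 < y) :
    ∫⁻ x in Ioc (0:ℝ) y, ENNReal.ofReal (x ^ (a - 1) * (y - x) ^ (b - 1))
      = ENNReal.ofReal (y ^ (a + b - 1) * eulerBeta a b) := by
  have himg : (fun u : ℝ => y * u) '' Ioo 0 1 = Ioo 0 y := by
    rw [Set.image_mul_left_Ioo hy]; simp
  rw [setLIntegral_congr Ioo_ae_eq_Ioc.symm, ← himg,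
    lintegral_image_eq_lintegral_abs_deriv_mul (f' := fun _ => y) measurableSet_Ioo
      (fun x _ => by simpa using ((hasDerivAt_id x).const_mul y).hasDerivWithinAt)
      (fun x _ z _ h => mul_left_cancel₀ hy.ne' h)]
  rw [ENNReal.ofReal_mul (by positivity), ← lint_beta ha hb, ← lintegral_const_mul _ (by fun_prop)]
  refine setLIntegral_congr_fun measurableSet_Ioo fun u hu => ?_
  have h1 : (0:ℝ) < 1 - u := by linarith [hu.2]
  rw [abs_of_pos hy, ← ENNReal.ofReal_mul hy.le, ← ENNReal.ofReal_mul (by positivity)]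
  congr 1
  rw [show y - y * u = y * (1 - u) by ring, Real.mul_rpow hy.le hu.1.le,
    Real.mul_rpow hy.le h1.le, show a + b - 1 = (a - 1) + (b - 1) + 1 by ring,
    Real.rpow_add hy, Real.rpow_add hy, Real.rpow_one]
  ring

lemma eulerBeta_pos {a b : ℝ} (ha : 0 < a) (hb : 0 < b) : 0 < eulerBeta a b :=
  ProbabilityTheory.beta_pos ha hb

/-- Rising factorial. -/
noncomputable def rise (a : ℝ) (k : ℕ) : ℝ := ∏ i ∈ Finset.range k, (a + i)

lemma rise_pos {a : ℝ} (ha : 0 < a) (k : ℕ) : 0 < rise a k :=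
  Finset.prod_pos fun i _ => by positivity

lemma Gamma_add_nat' {a : ℝ} (ha : 0 < a) (k : ℕ) :
    Real.Gamma (a + k) = Real.Gamma a * rise a k := by
  induction k with
  | zero => simp [rise]
  | succ k ih =>
    rw [rise, Finset.prod_range_succ, ← rise, ← mul_assoc, ← ih]
    push_cast
    rw [← add_assoc, Real.Gamma_add_one (by positivity)]
    ring

lemma eulerBeta_add_nat {a b : ℝ} (ha : 0 < a) (hb : 0 < b) (k : ℕ) :
    eulerBeta (a + k) b = eulerBeta a b * (rise a k / rise (a + b) k) := by
  unfold eulerBeta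
  rw [show a + k + b = a + b + k by ring, Gamma_add_nat' ha, Gamma_add_nat' (by positivity)]
  have := Real.Gamma_pos_of_pos (add_pos ha hb)
  have := rise_pos (add_pos ha hb) k
  field_simp

lemma rise_prod (n c k : ℕ) (hn : 0 < n) :
    (n : ℝ) ^ (n * k) * (∏ i ∈ Finset.range n, rise (((i : ℝ) + 1 + c) / n) k) * c.factorial
      = (n * k + c).factorial := by
  have hn' : (n : ℝ) ≠ 0 := by positivity
  induction k with
  | zero => simp [rise]
  | succ k ih =>
    have h1 : (n * (k + 1) + c).factorial =
        (n * k + c).factorial * ∏ i ∈ Finset.range n, (n * k + c + 1 + i) := by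
      rw [← Nat.ascFactorial_eq_prod_range, Nat.factorial_mul_ascFactorial]
      congr 1; ring
    rw [h1]
    push_cast
    rw [← ih]
    have h2 : ∀ i ∈ Finset.range n, rise (((i : ℝ) + 1 + c) / n) (k + 1) =
        rise (((i : ℝ) + 1 + c) / n) k * (((n * k + c + 1 + i : ℝ)) / n) := by
      intro i _
      rw [rise, Finset.prod_range_succ, ← rise]
      congr 1
      field_simp
      ring
    rw [Finset.prod_congr rfl h2, Finset.prod_mul_distrib, Finset.prod_div_distrib]
    simp only [Finset.prod_const, Finset.card_range]
    rw [mul_add, pow_add, mul_one]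
    field_simp

lemma rise_one (k : ℕ) : rise 1 k = k.factorial := by
  have := rise_prod 1 0 k one_pos
  simpa using this

lemma ext_of_moments {K : ℝ} (μ ν : Measure ℝ) [IsFiniteMeasure μ] [IsFiniteMeasure ν]
    (hμ : μ (Set.Icc (0 : ℝ) K)ᶜ = 0) (hν : ν (Set.Icc (0 : ℝ) K)ᶜ = 0)
    (h : ∀ k : ℕ, ∫ x, x ^ k ∂μ = ∫ x, x ^ k ∂ν) : μ = ν := by
  apply ext_of_forall_integral_eq_of_IsFiniteMeasure
  intro f
  have hpow : ∀ (ρ : Measure ℝ) [IsFiniteMeasure ρ] (_ : ρ (Set.Icc (0 : ℝ) K)ᶜ = 0) (p : Polynomial ℝ),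
      Integrable (fun x => p.eval x) ρ := by
    intro ρ _ hρ p
    have e : ρ.restrict (Set.Icc 0 K) = ρ :=
      Measure.restrict_eq_self_of_ae_mem (by rw [ae_iff]; exact hρ)
    rw [← e]
    exact (p.continuous.continuousOn).integrableOn_compact isCompact_Icc
  have hpoly : ∀ p : Polynomial ℝ, ∫ x, p.eval x ∂μ = ∫ x, p.eval x ∂ν := by
    intro p
    simp only [Polynomial.eval_eq_sum_range]
    rw [integral_finsetSum, integral_finsetSum]
    · simp_rw [integral_const_mul, h]
    · intro i _
      simpa using (hpow ν hν (Polynomial.X ^ i)).const_mul _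
    · intro i _
      simpa using (hpow μ hμ (Polynomial.X ^ i)).const_mul _
  have hclose : ∀ (ρ : Measure ℝ) [IsFiniteMeasure ρ] (_ : ρ (Set.Icc (0 : ℝ) K)ᶜ = 0)
      (p : Polynomial ℝ) (ε : ℝ), (∀ x ∈ Set.Icc 0 K, |p.eval x - f x| < ε) →
      |∫ x, p.eval x ∂ρ - ∫ x, f x ∂ρ| ≤ ε * ρ.real Set.univ := by
    intro ρ _ hρ p ε hp
    rw [← integral_sub (hpow ρ hρ p) (f.integrable ρ)]
    rw [← Real.norm_eq_abs]
    apply norm_integral_le_of_norm_le_const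
    have : ∀ᵐ x ∂ρ, x ∈ Set.Icc 0 K := by rw [ae_iff]; exact hρ
    filter_upwards [this] with x hx
    exact (hp x hx).le
  set C := μ.real Set.univ + ν.real Set.univ with hC
  have hC0 : 0 ≤ C := by positivity
  apply eq_of_abs_sub_le_all
  intro δ hδ
  obtain ⟨p, hp⟩ := exists_polynomial_near_of_continuousOn 0 K f f.continuous.continuousOn
    (δ / (C + 1)) (by positivity)
  have h1 := hclose μ hμ p _ hp
  have h2 := hclose ν hν p _ hp
  rw [hpoly] at h1
  have h3 : δ / (C + 1) * μ.real Set.univ + δ / (C + 1) * ν.real Set.univ ≤ δ := by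
    rw [← mul_add, ← hC, div_mul_eq_mul_div, div_le_iff₀ (by positivity)]
    nlinarith
  rw [abs_sub_comm] at h1
  calc _ ≤ _ := abs_sub_le _ (∫ x, p.eval x ∂ν) _
    _ ≤ _ := add_le_add h1 h2
    _ ≤ δ := h3

open Set in
lemma int_beta {a b : ℝ} (ha : 0 < a) (hb : 0 < b) :
    Integrable (fun u : ℝ => u ^ (a - 1) * (1 - u) ^ (b - 1)) (volume.restrict (Ioo 0 1)) ∧
    ∫ u in Ioo (0:ℝ) 1, u ^ (a - 1) * (1 - u) ^ (b - 1) = eulerBeta a b := by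
  have hnn : 0 ≤ᵐ[volume.restrict (Ioo (0:ℝ) 1)]
      (fun u : ℝ => u ^ (a - 1) * (1 - u) ^ (b - 1)) := by
    filter_upwards [ae_restrict_mem measurableSet_Ioo] with u hu
    have h1 : (0:ℝ) < 1 - u := by linarith [hu.2]
    have h0 := hu.1
    simp only [Pi.zero_apply]
    positivity
  have hm : AEStronglyMeasurable (fun u : ℝ => u ^ (a - 1) * (1 - u) ^ (b - 1))
      (volume.restrict (Ioo 0 1)) := Measurable.aestronglyMeasurable (by fun_prop)
  constructor
  · rw [← lintegral_ofReal_ne_top_iff_integrable hm hnn, lint_beta ha hb]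
    exact ENNReal.ofReal_ne_top
  · rw [integral_eq_lintegral_of_nonneg_ae hnn hm, lint_beta ha hb,
      ENNReal.toReal_ofReal (eulerBeta_pos ha hb).le]

noncomputable def aPar (s i : ℕ) : ℝ := ((i : ℝ) + 1) / ((s : ℝ) + 1)

noncomputable def bPar (s i : ℕ) : ℝ :=
  if i = 0 then ((s : ℝ) - 1) / (2 * (s : ℝ) + 2) else ((i : ℝ) + 1) / ((s : ℝ) * ((s : ℝ) + 1))

lemma aPar_pos (s i : ℕ) : 0 < aPar s i := by unfold aPar; positivity

lemma bPar_pos {s : ℕ} (hs : 2 ≤ s) (i : ℕ) : 0 < bPar s i := by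
  have : (2:ℝ) ≤ s := by exact_mod_cast hs
  unfold bPar
  split_ifs
  · apply div_pos <;> linarith
  · positivity

lemma ab_zero {s : ℕ} : aPar s 0 + bPar s 0 = 1 / 2 := by
  simp only [aPar, bPar, if_true]
  push_cast
  field_simp
  ring

lemma ab_succ {s : ℕ} (hs : 2 ≤ s) (i : ℕ) :
    aPar s (i + 1) + bPar s (i + 1) = ((i : ℝ) + 1 + 1) / s := by
  have : (0:ℝ) < s := by positivity
  simp only [aPar, bPar]
  rw [if_neg (by omega)]
  push_cast
  field_simp

lemma Fdens_eq (s : ℕ) (t : Fin s → ℝ) : Fdens s t = Cnorm s *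
    ∏ i : Fin s, (t i ^ (aPar s i - 1) * (1 - t i) ^ (bPar s i - 1)) := by
  unfold Fdens
  congr 1
  refine Finset.prod_congr rfl fun i _ => ?_
  unfold aPar bPar
  split_ifs with h
  · simp [h]
  · rfl

lemma Cnorm_eq {s : ℕ} (hs : 2 ≤ s) : Cnorm s =
    1 / ∏ i : Fin s, eulerBeta (aPar s i) (bPar s i) := by
  unfold Cnorm
  congr 1
  rw [Fin.prod_univ_eq_prod_range (fun i => eulerBeta (aPar s i) (bPar s i)) s]
  obtain ⟨r, rfl⟩ : ∃ r, s = r + 1 := ⟨s - 1, by omega⟩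
  rw [Finset.prod_range_succ', mul_comm]
  congr 1
  · rw [show Finset.Icc 2 (r + 1) = Finset.Ico 2 (r + 2) by ext; simp; omega,
      Finset.prod_Ico_eq_prod_range]
    refine Finset.prod_congr (by simp) fun i _ => ?_
    unfold aPar bPar
    rw [if_neg (by omega)]
    push_cast
    ring_nf
  · simp [aPar, bPar]

lemma Cnorm_pos {s : ℕ} (hs : 2 ≤ s) : 0 < Cnorm s := by
  rw [Cnorm_eq hs]
  exact one_div_pos.2 (Finset.prod_pos fun i _ => eulerBeta_pos (aPar_pos _ _) (bPar_pos hs _))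

/-- Open cube. -/
def ocube (s : ℕ) : Set (Fin s → ℝ) := Set.univ.pi fun _ => Set.Ioo (0 : ℝ) 1

lemma restrict_cube (s : ℕ) :
    (volume : Measure (Fin s → ℝ)).restrict (cube s) = volume.restrict (ocube s) := by
  apply Measure.restrict_congr_set
  unfold cube ocube
  rw [Set.pi_univ_Icc]
  exact (Measure.univ_pi_Ioo_ae_eq_Icc (μ := fun _ : Fin s => (volume : Measure ℝ))).symm

lemma measurableSet_ocube (s : ℕ) : MeasurableSet (ocube s) :=
  MeasurableSet.univ_pi fun _ => measurableSet_Ioo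

lemma tauProd_pos {s : ℕ} {t : Fin s → ℝ} (ht : t ∈ ocube s) : 0 < tauProd t :=
  Finset.prod_pos fun i _ => (ht i (Set.mem_univ i)).1

lemma tauProd_le {s : ℕ} {t : Fin s → ℝ} (ht : t ∈ ocube s) : tauProd t ≤ 1 :=
  Finset.prod_le_one (fun i _ => (ht i (Set.mem_univ i)).1.le)
    fun i _ => (ht i (Set.mem_univ i)).2.le

lemma Fdens_nonneg {s : ℕ} (hs : 2 ≤ s) {t : Fin s → ℝ} (ht : t ∈ ocube s) : 0 ≤ Fdens s t := by
  rw [Fdens_eq]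
  refine mul_nonneg (Cnorm_pos hs).le (Finset.prod_nonneg fun i _ => ?_)
  have h := ht i (Set.mem_univ i)
  exact mul_nonneg (Real.rpow_nonneg h.1.le _) (Real.rpow_nonneg (by linarith [h.2]) _)

lemma measurable_tauProd (s : ℕ) : Measurable (tauProd (s := s)) := by
  unfold tauProd; fun_prop

lemma measurable_Fdens (s : ℕ) : Measurable (Fdens s) := by
  have : Fdens s = fun t => Cnorm s *
    ∏ i : Fin s, (t i ^ (aPar s i - 1) * (1 - t i) ^ (bPar s i - 1)) := funext (Fdens_eq s)
  rw [this]; fun_prop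

lemma lint_F {s : ℕ} (hs : 2 ≤ s) (k : ℕ) :
    ∫⁻ t in ocube s, ENNReal.ofReal (tauProd t ^ k * Fdens s t)
      = ENNReal.ofReal (Cnorm s * ∏ i : Fin s, eulerBeta (aPar s i + k) (bPar s i)) := by
  have hb : ∀ i : Fin s, _ := fun i =>
    int_beta (a := aPar s i + k) (b := bPar s i)
      (by have := aPar_pos s i; positivity) (bPar_pos hs i)
  have hI : Integrable (fun t : Fin s → ℝ =>
      ∏ i, (t i ^ (aPar s i + k - 1) * (1 - t i) ^ (bPar s i - 1)))
      (volume.restrict (ocube s)) := by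
    rw [volume_pi, ocube, Measure.restrict_pi_pi]
    exact Integrable.fintype_prod (f := fun (i : Fin s) (u : ℝ) =>
      u ^ (aPar s i + k - 1) * (1 - u) ^ (bPar s i - 1)) fun i => (hb i).1
  have hE : ∫ t in ocube s, ∏ i, (t i ^ (aPar s i + k - 1) * (1 - t i) ^ (bPar s i - 1))
      = ∏ i : Fin s, eulerBeta (aPar s i + k) (bPar s i) := by
    rw [volume_pi, ocube, Measure.restrict_pi_pi]
    rw [integral_fintype_prod_eq_prod (fun (i : Fin s) (u : ℝ) =>
      u ^ (aPar s i + k - 1) * (1 - u) ^ (bPar s i - 1))]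
    exact Finset.prod_congr rfl fun i _ => (hb i).2
  rw [← hE, ← integral_const_mul, ofReal_integral_eq_lintegral_ofReal (hI.const_mul _)]
  · refine setLIntegral_congr_fun (measurableSet_ocube s) fun t ht => ?_
    congr 1
    rw [Fdens_eq, tauProd, ← Finset.prod_pow, mul_left_comm, ← Finset.prod_mul_distrib]
    congr 1
    refine Finset.prod_congr rfl fun i _ => ?_
    have h := (ht i (Set.mem_univ i)).1
    rw [show aPar s i + k - 1 = k + (aPar s i - 1) by ring, Real.rpow_add h, Real.rpow_natCast]
    ring
  · filter_upwards [ae_restrict_mem (measurableSet_ocube s)] with t ht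
    refine mul_nonneg (Cnorm_pos hs).le (Finset.prod_nonneg fun i _ => ?_)
    have h := ht i (Set.mem_univ i)
    exact mul_nonneg (Real.rpow_nonneg h.1.le _) (Real.rpow_nonneg (by linarith [h.2]) _)

lemma final_identity {s : ℕ} (hs : 2 ≤ s) (k : ℕ) :
    (1 / eulerBeta (1 / 2) (1 / 2 + 1 / (s : ℝ))) *
      (Kc s ^ k * eulerBeta (1 / 2 + k) (1 / 2 + 1 / (s : ℝ)) *
        (Cnorm s * ∏ i : Fin s, eulerBeta (aPar s i + k) (bPar s i)))
      = (1 / ((s : ℝ) * k + 1)) * (((s + 1) * k).choose k) := by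
  have hs0 : (0:ℝ) < s := by positivity
  rw [eulerBeta_add_nat (by norm_num) (by positivity), Cnorm_eq hs]
  have h1 : ∏ i : Fin s, eulerBeta (aPar s i + k) (bPar s i) =
      (∏ i : Fin s, eulerBeta (aPar s i) (bPar s i)) *
        ∏ i : Fin s, (rise (aPar s i) k / rise (aPar s i + bPar s i) k) := by
    rw [← Finset.prod_mul_distrib]
    exact Finset.prod_congr rfl fun i _ => eulerBeta_add_nat (aPar_pos _ _) (bPar_pos hs _) k
  have hP : 0 < ∏ i : Fin s, eulerBeta (aPar s i) (bPar s i) :=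
    Finset.prod_pos fun i _ => eulerBeta_pos (aPar_pos _ _) (bPar_pos hs _)
  have hB : 0 < eulerBeta (1 / 2) (1 / 2 + 1 / (s : ℝ)) :=
    eulerBeta_pos (by norm_num) (by positivity)
  have h2 : ∏ i : Fin s, rise (aPar s i) k = 
      ((s + 1) * k).factorial / (k.factorial * ((s:ℝ) + 1) ^ ((s + 1) * k)) := by
    rw [Fin.prod_univ_eq_prod_range (fun i => rise (aPar s i) k) s]
    have := rise_prod (s + 1) 0 k (by omega)
    rw [Finset.prod_range_succ] at this
    push_cast at this
    simp only [add_zero, Nat.factorial_zero, Nat.cast_one, mul_one] at this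
    rw [div_self (by positivity), rise_one] at this
    rw [eq_div_iff (by positivity), ← this]
    unfold aPar
    ring
  have h3 : rise (1 / 2 + (1 / 2 + 1 / (s : ℝ))) k *
      ∏ i : Fin s, rise (aPar s i + bPar s i) k =
      rise (1 / 2) k * ((s * k + 1).factorial / (s : ℝ) ^ (s * k)) := by
    rw [Fin.prod_univ_eq_prod_range (fun i => rise (aPar s i + bPar s i) k) s]
    have := rise_prod s 1 k (by omega)
    obtain ⟨r, rfl⟩ : ∃ r, s = r + 1 := ⟨s - 1, by omega⟩
    rw [Finset.prod_range_succ] at this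
    rw [Finset.prod_range_succ', ab_zero]
    simp_rw [ab_succ hs]
    rw [← this]
    have e : (1 / 2 + (1 / 2 + 1 / ((r + 1 : ℕ) : ℝ))) = ((r : ℝ) + 1 + (1 : ℕ)) / ((r + 1 : ℕ) : ℝ) := by
      push_cast
      field_simp
      ring
    rw [e]
    simp only [Nat.factorial_one, Nat.cast_one, mul_one]
    field_simp
  rw [h1, Finset.prod_div_distrib, h2]
  have hr : 0 < rise (1 / 2 : ℝ) k := rise_pos (by norm_num) k
  have hr2 : 0 < rise (1 / 2 + (1 / 2 + 1 / (s : ℝ))) k := rise_pos (by positivity) k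
  have hr3 : 0 < ∏ i : Fin s, rise (aPar s i + bPar s i) k :=
    Finset.prod_pos fun i _ => rise_pos (add_pos (aPar_pos _ _) (bPar_pos hs _)) k
  have h4 : ((((s + 1) * k).choose k : ℕ) : ℝ) * k.factorial * (s * k).factorial =
      ((s + 1) * k).factorial := by
    have := Nat.choose_mul_factorial_mul_factorial (n := (s + 1) * k) (k := k) (by nlinarith)
    rw [show (s + 1) * k - k = s * k by rw [add_mul]; omega] at this
    exact_mod_cast this
  have h5 : ((s * k + 1).factorial : ℝ) = (s * k + 1) * (s * k).factorial := by
    rw [Nat.factorial_succ]; push_cast; ring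
  have h6 : Kc s ^ k = ((s:ℝ) + 1) ^ ((s + 1) * k) / (s:ℝ) ^ (s * k) := by
    rw [Kc, div_pow, ← pow_mul, ← pow_mul]
  rw [h6, ← h4]
  set R := rise (1 / 2 : ℝ) k
  set R2 := rise (1 / 2 + (1 / 2 + 1 / (s : ℝ))) k
  set R3 := ∏ i : Fin s, rise (aPar s i + bPar s i) k
  set P := ∏ i : Fin s, eulerBeta (aPar s i) (bPar s i)
  set B := eulerBeta (1 / 2) (1 / 2 + 1 / (s : ℝ))
  have hf : (0:ℝ) < k.factorial := by positivity
  have hf2 : (0:ℝ) < (s * k).factorial := by positivity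
  have hsk : (0:ℝ) < (s:ℝ) * k + 1 := by positivity
  rw [h5] at h3
  have hX : (0:ℝ) < ((s:ℝ) + 1) ^ ((s + 1) * k) := by positivity
  have hY : (0:ℝ) < (s:ℝ) ^ (s * k) := by positivity
  generalize ((s:ℝ) + 1) ^ ((s + 1) * k) = X at *
  generalize (s:ℝ) ^ (s * k) = Y at *
  generalize ((((s + 1) * k).choose k : ℕ) : ℝ) = ch at *
  trans ch * (s * k).factorial * R / (Y * (R2 * R3))
  · field_simp
  · rw [h3]
    field_simp

/-- The integrand defining `piDens`. -/
noncomputable def gInt (s : ℕ) (x : ℝ) (t : Fin s → ℝ) : ℝ :=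
  if x ≤ tauProd t * Kc s then
    (tauProd t * Kc s - x) ^ (1 / (s : ℝ) - 1 / 2) * x ^ (-(1 : ℝ) / 2) *
      (tauProd t * Kc s) ^ (-(1 : ℝ) / (s : ℝ)) * Fdens s t
  else 0

lemma Kc_pos {s : ℕ} (hs : 2 ≤ s) : 0 < Kc s := by
  unfold Kc; positivity

lemma measurable_gInt (s : ℕ) :
    Measurable (fun p : ℝ × (Fin s → ℝ) => gInt s p.1 p.2) := by
  have h1 := measurable_Fdens s
  have h2 := measurable_tauProd s
  unfold gInt
  refine Measurable.ite (measurableSet_le (by fun_prop) (by fun_prop)) ?_ measurable_const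
  fun_prop

lemma gInt_nonneg {s : ℕ} (hs : 2 ≤ s) {x : ℝ} (hx : 0 < x) {t : Fin s → ℝ} (ht : t ∈ ocube s) :
    0 ≤ gInt s x t := by
  have h1 := Fdens_nonneg hs ht
  have h2 := mul_pos (tauProd_pos ht) (Kc_pos hs)
  unfold gInt
  split_ifs with h
  · have h3 := Real.rpow_nonneg (sub_nonneg.2 h) (1 / (s : ℝ) - 1 / 2)
    positivity
  · exact le_rfl

/-- The density as an extended nonnegative function. -/
noncomputable def hDens (s : ℕ) (x : ℝ) : ENNReal :=
  ENNReal.ofReal (1 / eulerBeta (1 / 2) (1 / 2 + 1 / (s : ℝ))) *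
    ∫⁻ t in ocube s, ENNReal.ofReal (gInt s x t)

lemma measurable_hDens (s : ℕ) : Measurable (hDens s) := by
  unfold hDens
  refine Measurable.const_mul ?_ _
  exact Measurable.lintegral_prod_right' (f := fun p : ℝ × (Fin s → ℝ) =>
    ENNReal.ofReal (gInt s p.1 p.2)) (measurable_gInt s).ennreal_ofReal

open Set in
lemma inner_int {s : ℕ} (hs : 2 ≤ s) (k : ℕ) {t : Fin s → ℝ} (ht : t ∈ ocube s) :
    ∫⁻ x in Ioc 0 (Kc s), ENNReal.ofReal (x ^ k) * ENNReal.ofReal (gInt s x t) =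
      ENNReal.ofReal (Kc s ^ k * eulerBeta (1 / 2 + k) (1 / 2 + 1 / (s : ℝ))) *
        ENNReal.ofReal (tauProd t ^ k * Fdens s t) := by
  have hs0 : (0:ℝ) < s := by positivity
  have hF := Fdens_nonneg hs ht
  have hK := Kc_pos hs
  have ht0 := tauProd_pos ht
  have hy : 0 < tauProd t * Kc s := mul_pos (tauProd_pos ht) (Kc_pos hs)
  have hyK : tauProd t * Kc s ≤ Kc s := mul_le_of_le_one_left (Kc_pos hs).le (tauProd_le ht)
  have hB : 0 < eulerBeta (1 / 2 + k) (1 / 2 + 1 / (s : ℝ)) :=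
    eulerBeta_pos (by positivity) (by positivity)
  set y := tauProd t * Kc s with hydef
  have e1 : ∫⁻ x in Ioc 0 (Kc s), ENNReal.ofReal (x ^ k) * ENNReal.ofReal (gInt s x t) =
      ∫⁻ x in Ioc 0 y, ENNReal.ofReal (x ^ k) * ENNReal.ofReal (gInt s x t) := by
    symm
    rw [← lintegral_indicator measurableSet_Ioc, ← lintegral_indicator measurableSet_Ioc]
    congr 1
    funext x
    by_cases h1 : x ∈ Ioc 0 y
    · rw [indicator_of_mem h1, indicator_of_mem (show x ∈ Ioc 0 (Kc s) from ⟨h1.1, h1.2.trans hyK⟩)]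
    · rw [indicator_of_notMem h1]
      by_cases h2 : x ∈ Ioc 0 (Kc s)
      · rw [indicator_of_mem h2, gInt, if_neg, ENNReal.ofReal_zero, mul_zero]
        intro h3
        exact h1 ⟨h2.1, h3⟩
      · rw [indicator_of_notMem h2]
  rw [e1]
  have e2 : ∀ x ∈ Ioc 0 y, ENNReal.ofReal (x ^ k) * ENNReal.ofReal (gInt s x t) =
      ENNReal.ofReal (y ^ (-(1 : ℝ) / (s : ℝ)) * Fdens s t) *
      ENNReal.ofReal (x ^ ((1 / 2 + k : ℝ) - 1) * (y - x) ^ ((1 / 2 + 1 / (s:ℝ)) - 1)) := by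
    intro x hx
    have hx0 := hx.1
    rw [← ENNReal.ofReal_mul (by positivity), ← ENNReal.ofReal_mul (by positivity)]
    congr 1
    rw [gInt, if_pos hx.2, show (1 / 2 + k : ℝ) - 1 = k + (-1 / 2) by ring,
      Real.rpow_add hx.1, Real.rpow_natCast, ← hydef,
      show (1 / 2 + 1 / (s:ℝ)) - 1 = 1 / (s : ℝ) - 1 / 2 by ring]
    ring
  rw [setLIntegral_congr_fun measurableSet_Ioc e2, lintegral_const_mul _ (by fun_prop),
    lint_beta_scaled (by positivity) (by positivity) hy, ← ENNReal.ofReal_mul (by positivity),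
    ← ENNReal.ofReal_mul (by positivity)]
  congr 1
  rw [show (1 / 2 + k : ℝ) + (1 / 2 + 1 / s) - 1 = k + 1 / s by ring, Real.rpow_add hy,
    Real.rpow_natCast, neg_div, Real.rpow_neg hy.le]
  have : 0 < y ^ (1 / (s:ℝ)) := by positivity
  field_simp
  rw [hydef, mul_pow]
  ring

open Set in
lemma moment_h {s : ℕ} (hs : 2 ≤ s) (k : ℕ) :
    ∫⁻ x in Ioc 0 (Kc s), hDens s x * ENNReal.ofReal (x ^ k) =
      ENNReal.ofReal ((1 / ((s : ℝ) * k + 1)) * (((s + 1) * k).choose k)) := by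
  have hs0 : (0:ℝ) < s := by positivity
  have hK := Kc_pos hs
  have hB0 : 0 < eulerBeta (1 / 2) (1 / 2 + 1 / (s : ℝ)) :=
    eulerBeta_pos (by positivity) (by positivity)
  have hB : 0 < eulerBeta (1 / 2 + k) (1 / 2 + 1 / (s : ℝ)) :=
    eulerBeta_pos (by positivity) (by positivity)
  have hg := (measurable_gInt s).ennreal_ofReal
  have hgx : ∀ x, Measurable fun t => ENNReal.ofReal (gInt s x t) := fun x =>
    hg.comp (measurable_const.prodMk measurable_id)
  have e : ∀ x, hDens s x * ENNReal.ofReal (x ^ k) =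
      ENNReal.ofReal (1 / eulerBeta (1 / 2) (1 / 2 + 1 / (s : ℝ))) *
      ∫⁻ t in ocube s, ENNReal.ofReal (x ^ k) * ENNReal.ofReal (gInt s x t) := by
    intro x
    rw [lintegral_const_mul _ (hgx x), hDens]
    ring
  simp_rw [e]
  have hm : Measurable (fun p : ℝ × (Fin s → ℝ) =>
      ENNReal.ofReal (p.1 ^ k) * ENNReal.ofReal (gInt s p.1 p.2)) :=
    Measurable.mul (by fun_prop) hg
  rw [lintegral_const_mul _ (Measurable.lintegral_prod_right' (f := fun p : ℝ × (Fin s → ℝ) =>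
      ENNReal.ofReal (p.1 ^ k) * ENNReal.ofReal (gInt s p.1 p.2)) hm),
    lintegral_lintegral_swap hm.aemeasurable,
    setLIntegral_congr_fun (measurableSet_ocube s) (fun t ht => inner_int hs k ht)]
  have h1 := measurable_Fdens s
  have h2 := measurable_tauProd s
  rw [lintegral_const_mul _ (by fun_prop), lint_F hs, ← ENNReal.ofReal_mul (by positivity),
    ← ENNReal.ofReal_mul (by positivity), final_identity hs]

open Set in
lemma hDens_ae {s : ℕ} (hs : 2 ≤ s) :
    ∀ᵐ x ∂(volume.restrict (Ioc 0 (Kc s))), ENNReal.ofReal (piDens s x) = hDens s x := by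
  have hs0 : (0:ℝ) < s := by positivity
  have hB0 : 0 < eulerBeta (1 / 2) (1 / 2 + 1 / (s : ℝ)) :=
    eulerBeta_pos (by positivity) (by positivity)
  have h0 := moment_h hs 0
  simp only [pow_zero, ENNReal.ofReal_one, mul_one] at h0
  have hfin : ∀ᵐ x ∂(volume.restrict (Ioc 0 (Kc s))), hDens s x < ⊤ :=
    ae_lt_top (measurable_hDens s) (by rw [h0]; exact ENNReal.ofReal_ne_top)
  filter_upwards [hfin, ae_restrict_mem measurableSet_Ioc] with x hx hx0
  have hm : Measurable fun t => gInt s x t :=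
    (measurable_gInt s).comp (measurable_const.prodMk measurable_id)
  have hnn : 0 ≤ᵐ[volume.restrict (ocube s)] fun t => gInt s x t := by
    filter_upwards [ae_restrict_mem (measurableSet_ocube s)] with t ht
    exact gInt_nonneg hs hx0.1 ht
  have hI : Integrable (fun t => gInt s x t) (volume.restrict (ocube s)) := by
    rw [← lintegral_ofReal_ne_top_iff_integrable hm.aestronglyMeasurable hnn]
    intro htop
    rw [hDens, htop, ENNReal.mul_top (by simpa using hB0)] at hx
    exact lt_irrefl _ hx
  have e : piDens s x = (1 / eulerBeta (1 / 2) (1 / 2 + 1 / (s : ℝ))) *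
    ∫ t in cube s, gInt s x t := rfl
  rw [e, restrict_cube, ENNReal.ofReal_mul (by positivity),
    ofReal_integral_eq_lintegral_ofReal hI hnn, hDens]

/-- For `s ≥ 2`: a Borel probability measure on `ℝ` supported in `[0, K]`
whose moments are the Fuss–Catalan numbers must be the measure with density `π_s · 1_{(0,K]}`
with respect to Lebesgue measure. -/
theorem measure_eq_of_fussCatalan_moments (s : ℕ) (hs : 2 ≤ s) (μ : Measure ℝ)
    [IsProbabilityMeasure μ] (hsupp : μ (Set.Icc (0 : ℝ) (Kc s))ᶜ = 0)
    (hmom : ∀ k : ℕ, ∫ x, x ^ k ∂μ = (1 / ((s : ℝ) * k + 1)) * (((s + 1) * k).choose k)) :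
    μ = volume.withDensity
      (fun x => ENNReal.ofReal ((Set.Ioc (0 : ℝ) (Kc s)).indicator (piDens s) x)) := by
  have hν : volume.withDensity
      (fun x => ENNReal.ofReal ((Set.Ioc (0 : ℝ) (Kc s)).indicator (piDens s) x)) =
      (volume.restrict (Set.Ioc (0 : ℝ) (Kc s))).withDensity (hDens s) := by
    rw [← withDensity_congr_ae (hDens_ae hs), ← withDensity_indicator measurableSet_Ioc]
    congr 1
    funext x
    by_cases hx : x ∈ Set.Ioc (0 : ℝ) (Kc s)
    · rw [Set.indicator_of_mem hx, Set.indicator_of_mem hx]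
    · rw [Set.indicator_of_notMem hx, Set.indicator_of_notMem hx, ENNReal.ofReal_zero]
  rw [hν]
  set ν := (volume.restrict (Set.Ioc (0 : ℝ) (Kc s))).withDensity (hDens s) with hνdef
  have hfin : IsFiniteMeasure ν := by
    apply isFiniteMeasure_withDensity
    have h0 := moment_h hs 0
    simp only [pow_zero, ENNReal.ofReal_one, mul_one] at h0
    rw [h0]
    exact ENNReal.ofReal_ne_top
  have hac : ν ≪ volume.restrict (Set.Ioc (0 : ℝ) (Kc s)) := withDensity_absolutelyContinuous _ _
  have hae : ∀ᵐ x ∂ν, x ∈ Set.Ioc (0 : ℝ) (Kc s) := hac.ae_le (ae_restrict_mem measurableSet_Ioc)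
  refine ext_of_moments (K := Kc s) μ ν hsupp ?_ ?_
  · have : ∀ᵐ x ∂ν, x ∈ Set.Icc (0 : ℝ) (Kc s) := by
      filter_upwards [hae] with x hx using ⟨hx.1.le, hx.2⟩
    rw [ae_iff] at this
    exact this
  · intro k
    rw [hmom k, integral_eq_lintegral_of_nonneg_ae]
    · rw [hνdef, lintegral_withDensity_eq_lintegral_mul _ (measurable_hDens s) (by fun_prop)]
      simp only [Pi.mul_apply]
      rw [moment_h hs k, ENNReal.toReal_ofReal (by positivity)]
    · filter_upwards [hae] with x hx
      exact pow_nonneg hx.1.le k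
    · exact Measurable.aestronglyMeasurable (by fun_prop)
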